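/- arXiv:2502.01310 — 5 statements merged into one kernel-verified Lean document; each statement's English description precedes it below -/
import Mathlib

section
/- Let X, Y ⊆ ℝ^D be nonempty compact sets with Y convex, let p be a Borel probability measure with p(X) = 1, let β > 0, and let φ : ℝ^D → ℝ be continuous and β-strongly convex on Y. Let T_φ : ℝ^D → ℝ^D be a Borel measurable map with T_φ(x) ∈ Y for all x ∈ X such that for every x ∈ X, T_φ(x) maximizes y ↦ ⟨x, y⟩ − φ(y) over Y. Let T* : ℝ^D → ℝ^D be a Borel measurable map with T*(x) ∈ Y for all x ∈ X, and let q be the push-forward of p under T*. Then: ∫ (⟨x, T_φ(x)⟩ − φ(T_φ(x))) dp(x) + ∫ φ(y) dq(y) − ∫ ⟨x, T*(x)⟩ dp(x) ≥ (β/2) ∫ ‖T*(x) − T_φ(x)‖² dp(x). -/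
open MeasureTheory
open scoped RealInnerProductSpace

theorem aux_int {E F : Type*} [TopologicalSpace F] [MeasurableSpace F] [OpensMeasurableSpace F]
    [MeasurableSpace E] (p : Measure E) [IsProbabilityMeasure p] (K : Set F) (hK : IsCompact K)
    (g : E → F) (hg : Measurable g) (hgK : ∀ᵐ x ∂p, g x ∈ K) (f : F → ℝ) (hf : Continuous f) :
    Integrable (fun x => f (g x)) p := by
  obtain ⟨C, hC⟩ := hK.exists_bound_of_continuousOn hf.continuousOn
  refine Integrable.of_bound (hf.measurable.comp hg).aestronglyMeasurable C ?_
  filter_upwards [hgK] with x hx using hC _ hx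

theorem aux_pt {E : Type*} [NormedAddCommGroup E] [InnerProductSpace ℝ E] (Y : Set E)
    (hYcv : Convex ℝ Y) (β : ℝ) (hβ : 0 < β) (φ : E → ℝ)
    (hsc : ConvexOn ℝ Y (fun y => φ y - β / 2 * ‖y‖ ^ 2)) (x a b : E) (ha : a ∈ Y) (hb : b ∈ Y)
    (hmax : ∀ y ∈ Y, ⟪x, y⟫ - φ y ≤ ⟪x, a⟫ - φ a) :
    β / 2 * ‖b - a‖ ^ 2 ≤ ⟪x, a⟫ - φ a + φ b - ⟪x, b⟫ := by
  have key : ∀ t : ℝ, 0 < t → t < 1 →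
      (1 - t) * (β / 2 * ‖b - a‖ ^ 2) ≤ ⟪x, a⟫ - φ a + φ b - ⟪x, b⟫ := by
    intro t h0 h1
    have hc := hsc.2 ha hb (by linarith : 0 ≤ 1 - t) h0.le (by ring)
    have hm := hmax _ (hYcv ha hb (by linarith : 0 ≤ 1 - t) h0.le (by ring))
    have hn : ‖(1 - t) • a + t • b‖ ^ 2
        = (1 - t) * ‖a‖ ^ 2 + t * ‖b‖ ^ 2 - t * (1 - t) * ‖b - a‖ ^ 2 := by
      rw [norm_add_sq_real, norm_sub_sq_real, norm_smul, norm_smul, mul_pow, mul_pow,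
        inner_smul_left, inner_smul_right, real_inner_comm a b]
      simp only [Real.norm_eq_abs, sq_abs, conj_trivial]
      ring
    simp only [smul_eq_mul, hn] at hc
    rw [inner_add_right, inner_smul_right, inner_smul_right] at hm
    refine le_of_mul_le_mul_left ?_ h0
    linear_combination hc + hm
  have hG := hmax b hb
  set M := β / 2 * ‖b - a‖ ^ 2
  by_contra! hlt
  have hM : 0 < M := by linarith
  set G := ⟪x, a⟫ - φ a + φ b - ⟪x, b⟫ with hGd
  have hG0 : 0 ≤ G := by linarith
  have := key ((M - G) / (2 * M)) (div_pos (by linarith) (by linarith))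
    (by rw [div_lt_one (by linarith)]; linarith)
  have h2 : (M - G) / (2 * M) * M = (M - G) / 2 := by field_simp
  linarith

theorem stmt_3 {D : ℕ} (X Y : Set (EuclideanSpace ℝ (Fin D)))
    (hXne : X.Nonempty) (hXc : IsCompact X) (hYne : Y.Nonempty) (hYc : IsCompact Y)
    (hYcv : Convex ℝ Y)
    (p : Measure (EuclideanSpace ℝ (Fin D))) [IsProbabilityMeasure p] (hpX : p X = 1)
    (β : ℝ) (hβ : 0 < β) (φ : EuclideanSpace ℝ (Fin D) → ℝ) (hφc : Continuous φ)
    (hsc : ConvexOn ℝ Y (fun y => φ y - β / 2 * ‖y‖ ^ 2))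
    (Tφ : EuclideanSpace ℝ (Fin D) → EuclideanSpace ℝ (Fin D))
    (hTφm : Measurable Tφ) (hTφY : ∀ x ∈ X, Tφ x ∈ Y)
    (hTφmax : ∀ x ∈ X, ∀ y ∈ Y, ⟪x, y⟫ - φ y ≤ ⟪x, Tφ x⟫ - φ (Tφ x))
    (Tstar : EuclideanSpace ℝ (Fin D) → EuclideanSpace ℝ (Fin D))
    (hTsm : Measurable Tstar) (hTsY : ∀ x ∈ X, Tstar x ∈ Y) :
    (∫ x, (⟪x, Tφ x⟫ - φ (Tφ x)) ∂p) + (∫ y, φ y ∂(Measure.map Tstar p))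
      - (∫ x, ⟪x, Tstar x⟫ ∂p) ≥
      β / 2 * ∫ x, ‖Tstar x - Tφ x‖ ^ 2 ∂p := by
  have hae : ∀ᵐ x ∂p, x ∈ X := (prob_compl_eq_zero_iff hXc.measurableSet).2 hpX
  have i1 : Integrable (fun x => ⟪x, Tφ x⟫ - φ (Tφ x)) p :=
    aux_int p (X ×ˢ Y) (hXc.prod hYc) (fun x => (x, Tφ x)) (measurable_id.prodMk hTφm)
      (hae.mono fun x hx => ⟨hx, hTφY x hx⟩) (fun z => ⟪z.1, z.2⟫ - φ z.2) (by fun_prop)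
  have i2 : Integrable (fun x => φ (Tstar x)) p :=
    aux_int p Y hYc Tstar hTsm (hae.mono hTsY) φ hφc
  have i3 : Integrable (fun x => ⟪x, Tstar x⟫) p :=
    aux_int p (X ×ˢ Y) (hXc.prod hYc) (fun x => (x, Tstar x)) (measurable_id.prodMk hTsm)
      (hae.mono fun x hx => ⟨hx, hTsY x hx⟩) (fun z => ⟪z.1, z.2⟫) (by fun_prop)
  have i4 : Integrable (fun x => ‖Tstar x - Tφ x‖ ^ 2) p :=
    aux_int p (Y ×ˢ Y) (hYc.prod hYc) (fun x => (Tstar x, Tφ x)) (hTsm.prodMk hTφm)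
      (hae.mono fun x hx => ⟨hTsY x hx, hTφY x hx⟩) (fun z => ‖z.1 - z.2‖ ^ 2) (by fun_prop)
  have i5 : Integrable (fun x => ⟪x, Tφ x⟫ - φ (Tφ x) + φ (Tstar x)) p := i1.add i2
  rw [integral_map hTsm.aemeasurable hφc.aestronglyMeasurable, ← integral_add i1 i2,
    ← integral_sub i5 i3, ← integral_const_mul]
  refine integral_mono_ae (i4.const_mul _) (i5.sub i3) ?_
  filter_upwards [hae] with x hx
  exact aux_pt Y hYcv β hβ φ hsc x _ _ (hTφY x hx) (hTsY x hx) (hTφmax x hx)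
end

section
/- Let X, Y ⊆ ℝ^D be nonempty compact sets with Y convex, let p be a Borel probability measure with p(X) = 1, let β > 0, and let φ̂ : ℝ^D → ℝ be continuous and β-strongly convex on Y. Let T̂, T_φ̂, T* : ℝ^D → ℝ^D be Borel measurable maps with values in Y on X, where for every x ∈ X the point T_φ̂(x) maximizes y ↦ ⟨x, y⟩ − φ̂(y) over Y, and the push-forward of p under T* equals q. Define E₁ = ∫ (⟨x, T_φ̂(x)⟩ − φ̂(T_φ̂(x))) dp(x) − ∫ (⟨x, T̂(x)⟩ − φ̂(T̂(x))) dp(x) and E₂ = ∫ (⟨x, T_φ̂(x)⟩ − φ̂(T_φ̂(x))) dp(x) + ∫ φ̂(y) dq(y) − ∫ ⟨x, T*(x)⟩ dp(x). Then ∫ ‖T̂(x) − T*(x)‖² dp(x) ≤ (4/β)(E₁ + E₂). -/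
open MeasureTheory
open scoped RealInnerProductSpace

theorem aux_growth {D : ℕ} {Y : Set (EuclideanSpace ℝ (Fin D))} (hYcv : Convex ℝ Y)
    {β : ℝ} (φ : EuclideanSpace ℝ (Fin D) → ℝ)
    (hsc : ConvexOn ℝ Y (fun y => φ y - β / 2 * ‖y‖ ^ 2))
    (x m y : EuclideanSpace ℝ (Fin D)) (hm : m ∈ Y) (hy : y ∈ Y)
    (hmax : ∀ y ∈ Y, ⟪x, y⟫ - φ y ≤ ⟪x, m⟫ - φ m) :
    β / 2 * ‖y - m‖ ^ 2 ≤ (⟪x, m⟫ - φ m) - (⟪x, y⟫ - φ y) := by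
  have key : ∀ t : ℝ, 0 < t → t < 1 →
      (1 - t) * (β / 2 * ‖y - m‖ ^ 2) ≤ (⟪x, m⟫ - φ m) - (⟪x, y⟫ - φ y) := by
    intro t ht0 ht1
    have h1 := hsc.2 hm hy (by linarith : 0 ≤ 1 - t) ht0.le (by ring)
    have h2 := hmax _ (hYcv hm hy (by linarith : 0 ≤ 1 - t) ht0.le (by ring))
    have h3 : ‖(1 - t) • m + t • y‖ ^ 2
        = (1 - t) * ‖m‖ ^ 2 + t * ‖y‖ ^ 2 - t * (1 - t) * ‖y - m‖ ^ 2 := by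
      rw [norm_add_sq_real, norm_sub_sq_real, norm_smul, norm_smul, inner_smul_left,
        inner_smul_right, mul_pow, mul_pow, Real.norm_eq_abs, Real.norm_eq_abs, sq_abs, sq_abs,
        real_inner_comm y m]
      simp only [conj_trivial]
      ring
    simp only [smul_eq_mul] at h1
    rw [h3] at h1
    rw [inner_add_right, inner_smul_right, inner_smul_right] at h2
    have h4 : t * ((1 - t) * (β / 2 * ‖y - m‖ ^ 2))
        ≤ t * ((⟪x, m⟫ - φ m) - (⟪x, y⟫ - φ y)) := by
      linarith
    exact le_of_mul_le_mul_left h4 ht0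
  have hB := hmax y hy
  generalize β / 2 * ‖y - m‖ ^ 2 = A at *
  generalize hBB : (⟪x, m⟫ - φ m) - (⟪x, y⟫ - φ y) = B at *
  have hB0 : 0 ≤ B := by linarith
  by_contra hlt
  push Not at hlt
  have hA : 0 < A := by linarith
  have h := key ((A - B) / (2 * A)) (by apply div_pos <;> linarith)
    (by rw [div_lt_one (by linarith)]; linarith)
  have e : (1 - (A - B) / (2 * A)) * A = (A + B) / 2 := by
    field_simp
    ring
  rw [e] at h
  linarith

theorem aux_int_s4 {D : ℕ} {X Y : Set (EuclideanSpace ℝ (Fin D))}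
    (hXc : IsCompact X) (hYc : IsCompact Y)
    (p : Measure (EuclideanSpace ℝ (Fin D))) [IsProbabilityMeasure p]
    (hX : ∀ᵐ x ∂p, x ∈ X)
    (F : EuclideanSpace ℝ (Fin D) × EuclideanSpace ℝ (Fin D) → ℝ) (hF : Continuous F)
    (T : EuclideanSpace ℝ (Fin D) → EuclideanSpace ℝ (Fin D))
    (hT : Measurable T) (hTY : ∀ x ∈ X, T x ∈ Y) :
    Integrable (fun x => F (x, T x)) p := by
  obtain ⟨C, hC⟩ := (hXc.prod hYc).exists_bound_of_continuousOn hF.continuousOn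
  refine Integrable.of_bound
    (hF.measurable.comp (measurable_id.prodMk hT)).aestronglyMeasurable C ?_
  filter_upwards [hX] with x hx
  exact hC _ ⟨hx, hTY x hx⟩

theorem stmt_4 {D : ℕ} (X Y : Set (EuclideanSpace ℝ (Fin D)))
    (hXne : X.Nonempty) (hXc : IsCompact X) (hYne : Y.Nonempty) (hYc : IsCompact Y)
    (hYcv : Convex ℝ Y)
    (p q : Measure (EuclideanSpace ℝ (Fin D)))
    [IsProbabilityMeasure p] [IsProbabilityMeasure q]
    (hpX : p X = 1) (hqY : q Y = 1)
    (β : ℝ) (hβ : 0 < β)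
    (φhat : EuclideanSpace ℝ (Fin D) → ℝ) (hφc : Continuous φhat)
    (hsc : ConvexOn ℝ Y (fun y => φhat y - β / 2 * ‖y‖ ^ 2))
    (That Tφhat Tstar : EuclideanSpace ℝ (Fin D) → EuclideanSpace ℝ (Fin D))
    (hThatm : Measurable That) (hThatY : ∀ x ∈ X, That x ∈ Y)
    (hTφm : Measurable Tφhat) (hTφY : ∀ x ∈ X, Tφhat x ∈ Y)
    (hTsm : Measurable Tstar) (hTsY : ∀ x ∈ X, Tstar x ∈ Y)
    (hTφmax : ∀ x ∈ X, ∀ y ∈ Y, ⟪x, y⟫ - φhat y ≤ ⟪x, Tφhat x⟫ - φhat (Tφhat x))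
    (hpush : Measure.map Tstar p = q)
    (E₁ E₂ : ℝ)
    (hE₁ : E₁ = (∫ x, (⟪x, Tφhat x⟫ - φhat (Tφhat x)) ∂p)
      - (∫ x, (⟪x, That x⟫ - φhat (That x)) ∂p))
    (hE₂ : E₂ = (∫ x, (⟪x, Tφhat x⟫ - φhat (Tφhat x)) ∂p)
      + (∫ y, φhat y ∂q) - (∫ x, ⟪x, Tstar x⟫ ∂p)) :
    ∫ x, ‖That x - Tstar x‖ ^ 2 ∂p ≤ 4 / β * (E₁ + E₂) := by
  have hX : ∀ᵐ x ∂p, x ∈ X :=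
    (mem_ae_iff_prob_eq_one (μ := p) hXc.measurableSet).2 hpX
  have hc1 : Continuous (fun z : EuclideanSpace ℝ (Fin D) × EuclideanSpace ℝ (Fin D) =>
      ⟪z.1, z.2⟫ - φhat z.2) := by fun_prop
  have hc2 : Continuous (fun z : EuclideanSpace ℝ (Fin D) × EuclideanSpace ℝ (Fin D) =>
      ⟪z.1, z.2⟫) := by fun_prop
  have hc3 : Continuous (fun z : EuclideanSpace ℝ (Fin D) × EuclideanSpace ℝ (Fin D) =>
      φhat z.2) := by fun_prop
  have iφ := aux_int_s4 hXc hYc p hX _ hc1 Tφhat hTφm hTφY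
  have ih := aux_int_s4 hXc hYc p hX _ hc1 That hThatm hThatY
  have is1 := aux_int_s4 hXc hYc p hX _ hc2 Tstar hTsm hTsY
  have is2 := aux_int_s4 hXc hYc p hX _ hc3 Tstar hTsm hTsY
  have is := aux_int_s4 hXc hYc p hX _ hc1 Tstar hTsm hTsY
  simp only at iφ ih is1 is2 is
  have hq : ∫ y, φhat y ∂q = ∫ x, φhat (Tstar x) ∂p := by
    rw [← hpush]
    exact integral_map hTsm.aemeasurable hφc.aestronglyMeasurable
  have hsum : E₁ + E₂ = ∫ x, (((⟪x, Tφhat x⟫ - φhat (Tφhat x)) - (⟪x, That x⟫ - φhat (That x)))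
      + ((⟪x, Tφhat x⟫ - φhat (Tφhat x)) - (⟪x, Tstar x⟫ - φhat (Tstar x)))) ∂p := by
    rw [integral_add (by exact iφ.sub ih) (by exact iφ.sub is), integral_sub iφ ih, integral_sub iφ is,
      integral_sub is1 is2, hE₁, hE₂, hq]
    ring
  rw [hsum, ← integral_const_mul]
  refine integral_mono_of_nonneg (Filter.Eventually.of_forall fun x => by positivity)
    (((iφ.sub ih).add (iφ.sub is)).const_mul _) ?_
  filter_upwards [hX] with x hx
  have g1 := aux_growth hYcv φhat hsc x _ _ (hTφY x hx) (hThatY x hx) (hTφmax x hx)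
  have g2 := aux_growth hYcv φhat hsc x _ _ (hTφY x hx) (hTsY x hx) (hTφmax x hx)
  have tri : ‖That x - Tstar x‖ ^ 2
      ≤ 2 * ‖That x - Tφhat x‖ ^ 2 + 2 * ‖Tstar x - Tφhat x‖ ^ 2 := by
    have h := norm_sub_le (That x - Tφhat x) (Tstar x - Tφhat x)
    rw [sub_sub_sub_cancel_right] at h
    nlinarith [norm_nonneg (That x - Tstar x),
      sq_nonneg (‖That x - Tφhat x‖ - ‖Tstar x - Tφhat x‖)]
  refine tri.trans ?_
  have h := mul_le_mul_of_nonneg_left (add_le_add g1 g2) (by positivity : 0 ≤ 4 / β)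
  refine le_trans (le_of_eq ?_) h
  field_simp
  ring
end

section
/- Let X, Y ⊆ ℝ^D be nonempty compact sets, let φ : ℝ^D → ℝ be continuous on Y, and let B > 0. Define φ̄(x) = max_{y ∈ Y} (⟨x, y⟩ − φ(y)) and φ_L(y) = max_{x ∈ X} (⟨x, y⟩ − φ̄(x) − ‖x‖²/(2B)). Assume the biconjugation identity φ(y) = max_{x ∈ X} (⟨x, y⟩ − φ̄(x)) for all y ∈ Y. Then: (i) 0 ≤ φ(y) − φ_L(y) ≤ (max_{x ∈ X} ‖x‖²)/(2B) for all y ∈ Y; (ii) φ_L is convex on ℝ^D; and (iii) φ_L is Lipschitz on ℝ^D with Lipschitz constant at most max_{x ∈ X} ‖x‖. -/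
open scoped RealInnerProductSpace

/-- Restricted convex conjugate of `φ` over the set `S`. -/
noncomputable def restConj {D : ℕ} (S : Set (EuclideanSpace ℝ (Fin D)))
    (φ : EuclideanSpace ℝ (Fin D) → ℝ) (x : EuclideanSpace ℝ (Fin D)) : ℝ :=
  sSup ((fun y => ⟪x, y⟫ - φ y) '' S)

/-- The Lipschitz regularization of `φ`: the restricted conjugate over `X` of the
regularized conjugate `restConj Y φ + ‖·‖²/(2B)`. -/
noncomputable def philow {D : ℕ} (X Y : Set (EuclideanSpace ℝ (Fin D))) (B : ℝ)
    (φ : EuclideanSpace ℝ (Fin D) → ℝ) (y : EuclideanSpace ℝ (Fin D)) : ℝ :=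
  sSup ((fun x => ⟪x, y⟫ - restConj Y φ x - ‖x‖ ^ 2 / (2 * B)) '' X)

theorem stmt_12 {D : ℕ} (X Y : Set (EuclideanSpace ℝ (Fin D)))
    (hXne : X.Nonempty) (hXc : IsCompact X) (hYne : Y.Nonempty) (hYc : IsCompact Y)
    (φ : EuclideanSpace ℝ (Fin D) → ℝ) (hφ : ContinuousOn φ Y)
    (B : ℝ) (hB : 0 < B)
    (hbi : ∀ y ∈ Y, φ y = restConj X (restConj Y φ) y) :
    (∀ y ∈ Y, 0 ≤ φ y - philow X Y B φ y ∧
      φ y - philow X Y B φ y ≤ sSup ((fun x => ‖x‖ ^ 2) '' X) / (2 * B)) ∧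
    ConvexOn ℝ Set.univ (philow X Y B φ) ∧
    (∀ y y' : EuclideanSpace ℝ (Fin D),
      |philow X Y B φ y - philow X Y B φ y'| ≤ sSup ((fun x => ‖x‖) '' X) * ‖y - y'‖) := by
  obtain ⟨y0, hy0⟩ := hYne
  set M := sSup ((fun x : EuclideanSpace ℝ (Fin D) => ‖x‖) '' X) with hM
  have bN : BddAbove ((fun x : EuclideanSpace ℝ (Fin D) => ‖x‖) '' X) :=
    hXc.bddAbove_image continuous_norm.continuousOn
  have bN2 : BddAbove ((fun x : EuclideanSpace ℝ (Fin D) => ‖x‖ ^ 2) '' X) :=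
    hXc.bddAbove_image (by fun_prop)
  have hMle : ∀ x ∈ X, ‖x‖ ≤ M := fun x hx => le_csSup bN ⟨x, hx, rfl⟩
  have hconj : ∀ x, ⟪x, y0⟫ - φ y0 ≤ restConj Y φ x := fun x =>
    le_csSup (hYc.bddAbove_image (f := fun y => ⟪x, y⟫ - φ y)
      (ContinuousOn.sub (by fun_prop) hφ)) ⟨y0, hy0, rfl⟩
  have key : ∀ y, ∀ x ∈ X, ⟪x, y⟫ - restConj Y φ x ≤ M * ‖y - y0‖ + φ y0 := by
    intro y x hx
    have h1 := hconj x
    have h2 := real_inner_le_norm x (y - y0)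
    have h3 := mul_le_mul_of_nonneg_right (hMle x hx) (norm_nonneg (y - y0))
    rw [inner_sub_right] at h2
    linarith
  have hq : ∀ x : EuclideanSpace ℝ (Fin D), 0 ≤ ‖x‖ ^ 2 / (2 * B) := fun x => by positivity
  have b1 : ∀ y, BddAbove ((fun x => ⟪y, x⟫ - restConj Y φ x) '' X) := by
    intro y
    refine ⟨M * ‖y - y0‖ + φ y0, ?_⟩
    rintro _ ⟨x, hx, rfl⟩
    have := key y x hx
    rw [real_inner_comm] at this
    exact this
  have b2 : ∀ y, BddAbove ((fun x => ⟪x, y⟫ - restConj Y φ x - ‖x‖ ^ 2 / (2 * B)) '' X) := by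
    intro y
    refine ⟨M * ‖y - y0‖ + φ y0, ?_⟩
    rintro _ ⟨x, hx, rfl⟩
    have := key y x hx
    have := hq x
    dsimp only
    linarith
  have le1 : ∀ y, ∀ x ∈ X, ⟪x, y⟫ - restConj Y φ x ≤ restConj X (restConj Y φ) y := by
    intro y x hx
    rw [real_inner_comm]
    exact le_csSup (b1 y) ⟨x, hx, rfl⟩
  have le2 : ∀ y, ∀ x ∈ X,
      ⟪x, y⟫ - restConj Y φ x - ‖x‖ ^ 2 / (2 * B) ≤ philow X Y B φ y :=
    fun y x hx => le_csSup (b2 y) ⟨x, hx, rfl⟩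
  have ub : ∀ y c, (∀ x ∈ X, ⟪x, y⟫ - restConj Y φ x - ‖x‖ ^ 2 / (2 * B) ≤ c) →
      philow X Y B φ y ≤ c := by
    intro y c h
    refine csSup_le (hXne.image _) ?_
    rintro _ ⟨x, hx, rfl⟩
    exact h x hx
  refine ⟨?_, ⟨convex_univ, ?_⟩, ?_⟩
  · intro y hy
    rw [hbi y hy]
    constructor
    · have := ub y (restConj X (restConj Y φ) y) (fun x hx => by
        have := le1 y x hx
        have := hq x
        linarith)
      linarith
    · have : restConj X (restConj Y φ) y ≤ philow X Y B φ y +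
          sSup ((fun x : EuclideanSpace ℝ (Fin D) => ‖x‖ ^ 2) '' X) / (2 * B) := by
        refine csSup_le (hXne.image _) ?_
        rintro _ ⟨x, hx, rfl⟩
        have h1 := le2 y x hx
        have h2 : ‖x‖ ^ 2 / (2 * B) ≤
            sSup ((fun x : EuclideanSpace ℝ (Fin D) => ‖x‖ ^ 2) '' X) / (2 * B) :=
          div_le_div_of_nonneg_right (le_csSup bN2 ⟨x, hx, rfl⟩) (by positivity)
        rw [real_inner_comm] at h1
        dsimp only
        linarith
      linarith
  · intro y _ z _ a b ha hb hab
    apply ub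
    intro x hx
    have h1 := mul_le_mul_of_nonneg_left (le2 y x hx) ha
    have h2 := mul_le_mul_of_nonneg_left (le2 z x hx) hb
    rw [inner_add_right, inner_smul_right, inner_smul_right]
    simp only [smul_eq_mul]
    obtain rfl : b = 1 - a := by linarith
    linarith
  · have half : ∀ y z, philow X Y B φ y ≤ philow X Y B φ z + M * ‖y - z‖ := by
      intro y z
      apply ub
      intro x hx
      have h1 := le2 z x hx
      have h2 := real_inner_le_norm x (y - z)
      have h3 := mul_le_mul_of_nonneg_right (hMle x hx) (norm_nonneg (y - z))
      rw [inner_sub_right] at h2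
      linarith
    intro y z
    have h1 := half y z
    have h2 := half z y
    rw [norm_sub_rev] at h2
    rw [abs_le]
    constructor <;> linarith
end

section
/- Let Y ⊆ ℝ^D be a nonempty compact set and let ε > 0, L > 0, C > 0. Then there exist K ∈ ℕ and a bound b₀ = C + L·max_{y∈Y}‖y‖ such that for every convex function φ : ℝ^D → ℝ with |φ(y) − φ(y')| ≤ L‖y − y'‖ for all y, y' ∈ ℝ^D and |φ(y)| ≤ C for all y ∈ Y, there exist n ≤ K, vectors μ₁, …, μ_n ∈ ℝ^D with ‖μᵢ‖ ≤ L, and scalars b₁, …, b_n ∈ ℝ with |bᵢ| ≤ b₀, such that the piecewise-affine function φ̂(y) = max_{1≤i≤n} (⟨μᵢ, y⟩ + bᵢ) satisfies φ̂(y) ≤ φ(y) and φ(y) − φ̂(y) ≤ ε for all y ∈ Y. The number K depends only on Y, ε and L, not on the particular φ. -/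
open scoped RealInnerProductSpace

theorem subgrad_aux {D : ℕ} (φ : EuclideanSpace ℝ (Fin D) → ℝ) (hφ : ConvexOn ℝ Set.univ φ)
    (hc : Continuous φ) (x : EuclideanSpace ℝ (Fin D)) :
    ∃ μ : EuclideanSpace ℝ (Fin D), ∀ w, φ x + ⟪μ, w - x⟫ ≤ φ w := by
  have hopen : IsOpen {p : EuclideanSpace ℝ (Fin D) × ℝ | p.1 ∈ Set.univ ∧ φ p.1 < p.2} := by
    simp only [Set.mem_univ, true_and]
    exact isOpen_lt (hc.comp continuous_fst) continuous_snd
  obtain ⟨f, hf⟩ := geometric_hahn_banach_point_open (x := (x, φ x)) hφ.convex_strict_epigraph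
    hopen (by simp)
  have hdec : ∀ (w : EuclideanSpace ℝ (Fin D)) (r : ℝ), f (w, r) = f (w, 0) + r * f (0, 1) := by
    intro w r
    have : ((w, r) : EuclideanSpace ℝ (Fin D) × ℝ) = (w, 0) + r • (0, 1) := by simp
    rw [this, map_add, map_smul, smul_eq_mul]
  have hpos : 0 < f (0, 1) := by
    have h := hf (x, φ x + 1) (by simp)
    rw [hdec x (φ x), hdec x (φ x + 1)] at h
    linarith
  set c := f (0, 1) with hcdef
  let u : StrongDual ℝ (EuclideanSpace ℝ (Fin D)) :=
    (-c⁻¹) • (f.comp (ContinuousLinearMap.inl ℝ (EuclideanSpace ℝ (Fin D)) ℝ))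
  refine ⟨(InnerProductSpace.toDual ℝ _).symm u, fun w => ?_⟩
  rw [InnerProductSpace.toDual_symm_apply]
  have hu : u (w - x) = c⁻¹ * (f (x, 0) - f (w, 0)) := by
    rw [map_sub]
    simp [u]
    ring
  rw [hu]
  refine le_of_forall_pos_le_add fun δ hδ => ?_
  have h := hf (w, φ w + δ) (by simpa using hδ)
  rw [hdec x (φ x), hdec w (φ w + δ)] at h
  have h2 : c⁻¹ * (f (x, 0) - f (w, 0)) ≤ φ w + δ - φ x := by
    rw [inv_mul_le_iff₀ hpos]
    linarith
  linarith

theorem stmt_13 {D : ℕ} (Y : Set (EuclideanSpace ℝ (Fin D)))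
    (hYne : Y.Nonempty) (hYc : IsCompact Y)
    (ε L : ℝ) (hε : 0 < ε) (hL : 0 < L) :
    ∃ K : ℕ, ∀ C : ℝ, 0 < C →
      ∀ φ : EuclideanSpace ℝ (Fin D) → ℝ, ConvexOn ℝ Set.univ φ →
        (∀ y y' : EuclideanSpace ℝ (Fin D), |φ y - φ y'| ≤ L * ‖y - y'‖) →
        (∀ y ∈ Y, |φ y| ≤ C) →
        ∃ n : ℕ, 1 ≤ n ∧ n ≤ K ∧
          ∃ (μ : Fin n → EuclideanSpace ℝ (Fin D)) (b : Fin n → ℝ),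
            (∀ i, ‖μ i‖ ≤ L) ∧
            (∀ i, |b i| ≤ C + L * sSup ((fun y => ‖y‖) '' Y)) ∧
            ∀ y ∈ Y,
              (⨆ i, (⟪μ i, y⟫ + b i)) ≤ φ y ∧
              φ y - (⨆ i, (⟪μ i, y⟫ + b i)) ≤ ε := by
  obtain ⟨t, htY, htf, hcov⟩ := hYc.finite_cover_balls (e := ε / (2 * L)) (by positivity)
  lift t to Finset (EuclideanSpace ℝ (Fin D)) using htf
  have htne : t.Nonempty := by
    obtain ⟨y, hy⟩ := hYne
    obtain ⟨z, hz, -⟩ := Set.mem_iUnion₂.1 (hcov hy)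
    exact ⟨z, hz⟩
  refine ⟨t.card, fun C _ φ hφ hlip hbd => ⟨t.card, htne.card_pos, le_rfl, ?_⟩⟩
  have hc : Continuous φ := by
    refine (LipschitzWith.of_dist_le_mul (K := ⟨L, hL.le⟩) fun y y' => ?_).continuous
    rw [Real.dist_eq, dist_eq_norm]
    exact hlip y y'
  choose g hg using subgrad_aux φ hφ hc
  have hgn : ∀ x, ‖g x‖ ≤ L := by
    intro x
    have h1 := hg x (x + g x)
    have h2 := (le_abs_self _).trans (hlip (x + g x) x)
    simp only [add_sub_cancel_left, real_inner_self_eq_norm_sq] at h1 h2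
    by_contra! h
    nlinarith [norm_nonneg (g x)]
  let e := t.equivFin.symm
  have heY : ∀ i, (e i : EuclideanSpace ℝ (Fin D)) ∈ Y := fun i => htY (e i).2
  have hne : Nonempty (Fin t.card) := ⟨⟨0, htne.card_pos⟩⟩
  refine ⟨fun i => g (e i), fun i => φ (e i) - ⟪g (e i), (e i : EuclideanSpace ℝ (Fin D))⟫,
    fun i => hgn _, fun i => ?_, fun y hy => ⟨?_, ?_⟩⟩
  · have h1 := hbd _ (heY i)
    have h2 : ‖(e i : EuclideanSpace ℝ (Fin D))‖ ≤ sSup ((fun y => ‖y‖) '' Y) :=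
      le_csSup (hYc.image continuous_norm).bddAbove ⟨_, heY i, rfl⟩
    have h3 := abs_real_inner_le_norm (g (e i)) (e i : EuclideanSpace ℝ (Fin D))
    have h4 := mul_le_mul (hgn (e i)) h2 (norm_nonneg _) hL.le
    exact (abs_sub _ _).trans (by linarith)
  · refine ciSup_le fun i => ?_
    have := hg (e i) y
    rw [inner_sub_right] at this
    linarith
  · obtain ⟨z, hz, hyz⟩ := Set.mem_iUnion₂.1 (hcov hy)
    have hle := le_ciSup (f := fun i => ⟪g (e i), y⟫ +
      (φ (e i) - ⟪g (e i), (e i : EuclideanSpace ℝ (Fin D))⟫))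
      (Set.finite_range _).bddAbove (t.equivFin ⟨z, hz⟩)
    simp only [e, Equiv.symm_apply_apply] at hle
    rw [Metric.mem_ball, dist_eq_norm, lt_div_iff₀ (by positivity)] at hyz
    have h1 := (le_abs_self _).trans (hlip y z)
    have h2 := (neg_le_abs _).trans (abs_real_inner_le_norm (g z) (y - z))
    have h3 := mul_le_mul_of_nonneg_right (hgn z) (norm_nonneg (y - z))
    rw [inner_sub_right] at h2
    simp only [e]
    linarith
end

section
/- Let X, Y ⊆ ℝ^D be nonempty compact sets with Y convex, let p be a Borel probability measure with p(X) = 1, let β > 0 and L₀ > 0. Let 𝓕 be a nonempty family of continuous functions φ : ℝ^D → ℝ, each β-strongly convex on Y and each satisfying |φ(y) − φ(y')| ≤ L₀‖y − y'‖ for all y, y' ∈ Y. Assume 𝓕 is totally bounded with respect to the Lipschitz seminorm on Y: for every δ > 0 there is a finite subset {φ₁, …, φ_k} ⊆ 𝓕 such that every φ ∈ 𝓕 satisfies |(φ − φᵢ)(y) − (φ − φᵢ)(y')| ≤ δ‖y − y'‖ for all y, y' ∈ Y, for some i. Then for every ε > 0 there exists a finite set 𝒯 of Borel measurable maps T : ℝ^D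 → ℝ^D with T(x) ∈ Y for all x ∈ X, such that for every φ ∈ 𝓕: ∫ max_{y ∈ Y} (⟨x, y⟩ − φ(y)) dp(x) − max_{T ∈ 𝒯} ∫ (⟨x, T(x)⟩ − φ(T(x))) dp(x) ≤ ε. -/
open MeasureTheory
open scoped RealInnerProductSpace

theorem stmt_17 {D : ℕ} (X Y : Set (EuclideanSpace ℝ (Fin D)))
    (hXne : X.Nonempty) (hXc : IsCompact X) (hYne : Y.Nonempty) (hYc : IsCompact Y)
    (hYcv : Convex ℝ Y)
    (p : Measure (EuclideanSpace ℝ (Fin D))) [IsProbabilityMeasure p] (hpX : p X = 1)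
    (β L₀ : ℝ) (hβ : 0 < β) (hL₀ : 0 < L₀)
    (𝓕 : Set (EuclideanSpace ℝ (Fin D) → ℝ)) (h𝓕ne : 𝓕.Nonempty)
    (hcont : ∀ φ ∈ 𝓕, Continuous φ)
    (hsc : ∀ φ ∈ 𝓕, ConvexOn ℝ Y (fun y => φ y - β / 2 * ‖y‖ ^ 2))
    (hLip : ∀ φ ∈ 𝓕, ∀ y ∈ Y, ∀ y' ∈ Y, |φ y - φ y'| ≤ L₀ * ‖y - y'‖)
    (htb : ∀ δ : ℝ, 0 < δ →
      ∃ (k : ℕ) (φs : Fin k → (EuclideanSpace ℝ (Fin D) → ℝ)),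
        (∀ i, φs i ∈ 𝓕) ∧
        ∀ φ ∈ 𝓕, ∃ i, ∀ y ∈ Y, ∀ y' ∈ Y,
          |(φ y - φs i y) - (φ y' - φs i y')| ≤ δ * ‖y - y'‖) :
    ∀ ε : ℝ, 0 < ε →
      ∃ 𝒯 : Set (EuclideanSpace ℝ (Fin D) → EuclideanSpace ℝ (Fin D)),
        𝒯.Finite ∧ 𝒯.Nonempty ∧
        (∀ T ∈ 𝒯, Measurable T ∧ ∀ x ∈ X, T x ∈ Y) ∧
        ∀ φ ∈ 𝓕,
          (∫ x, sSup ((fun y => ⟪x, y⟫ - φ y) '' Y) ∂p)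
            - sSup ((fun T => ∫ x, (⟪x, T x⟫ - φ (T x)) ∂p) '' 𝒯) ≤ ε := by
  classical
  intro ε hε
  obtain ⟨R, hRpos, hR⟩ : ∃ R : ℝ, 0 < R ∧ ∀ y ∈ Y, ‖y‖ ≤ R := by
    obtain ⟨R, h0, hR⟩ := hYc.isBounded.exists_pos_norm_le
    exact ⟨R, h0, hR⟩
  obtain ⟨C, hCpos, hC⟩ : ∃ C : ℝ, 0 < C ∧ ∀ x ∈ X, ‖x‖ ≤ C := by
    obtain ⟨C, h0, hC⟩ := hXc.isBounded.exists_pos_norm_le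
    exact ⟨C, h0, hC⟩
  obtain ⟨η, hη, hηe⟩ : ∃ η : ℝ, 0 < η ∧ 2 * R * η ≤ ε / 2 :=
    ⟨ε / (4 * R), by positivity, le_of_eq (by field_simp; norm_num)⟩
  obtain ⟨δ, hδ, hδe⟩ : ∃ δ : ℝ, 0 < δ ∧ δ * (2 * R) ≤ ε / 2 :=
    ⟨ε / (4 * R), by positivity, le_of_eq (by field_simp; norm_num)⟩
  obtain ⟨k, φs, hφs, hk⟩ := htb δ hδ
  have hg : ∀ i : Fin k, ∀ z : EuclideanSpace ℝ (Fin D), ∃ y ∈ Y, ∀ y' ∈ Y,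
      ⟪z, y'⟫ - φs i y' ≤ ⟪z, y⟫ - φs i y := by
    intro i z
    have hc : ContinuousOn (fun y => ⟪z, y⟫ - φs i y) Y :=
      ((continuous_const.inner continuous_id).sub (hcont _ (hφs i))).continuousOn
    obtain ⟨y, hy, hm⟩ := hYc.exists_isMaxOn hYne hc
    exact ⟨y, hy, fun y' hy' => hm hy'⟩
  choose g hgY hgm using hg
  let e := TopologicalSpace.denseSeq (EuclideanSpace ℝ (Fin D))
  obtain ⟨N, hN⟩ : ∃ N : ℕ, ∀ x ∈ X, ∃ n ≤ N, dist (e n) x ≤ η := by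
    obtain ⟨t, ht⟩ := hXc.elim_finite_subcover (fun n => Metric.ball (e n) η)
      (fun n => Metric.isOpen_ball) (by
        intro x _
        obtain ⟨n, hn⟩ := (TopologicalSpace.denseRange_denseSeq
          (EuclideanSpace ℝ (Fin D))).exists_dist_lt x hη
        exact Set.mem_iUnion.2 ⟨n, hn⟩)
    refine ⟨t.sup id, fun x hx => ?_⟩
    obtain ⟨n, hn, hxn⟩ := Set.mem_iUnion₂.1 (ht hx)
    refine ⟨n, Finset.le_sup (f := id) hn, ?_⟩
    rw [dist_comm]
    exact (Metric.mem_ball.1 hxn).le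
  let P := SimpleFunc.nearestPt e N
  have hP : ∀ x ∈ X, ‖P x - x‖ ≤ η := by
    intro x hx
    obtain ⟨n, hn, hd⟩ := hN x hx
    have h := SimpleFunc.edist_nearestPt_le e x hn
    rw [edist_dist, edist_dist, ENNReal.ofReal_le_ofReal_iff dist_nonneg] at h
    rw [← dist_eq_norm]
    exact h.trans hd
  let T : Fin k → SimpleFunc (EuclideanSpace ℝ (Fin D)) (EuclideanSpace ℝ (Fin D)) :=
    fun i => P.map (g i)
  have hTY : ∀ i x, T i x ∈ Y := fun i x => hgY i (P x)
  have hae : ∀ᵐ x ∂p, x ∈ X := (mem_ae_iff_prob_eq_one hXc.measurableSet).2 hpX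
  have hres : p.restrict X = p := Measure.restrict_eq_self_of_ae_mem hae
  refine ⟨Set.range (fun i => (T i : _ → _)), Set.finite_range _, ?_, ?_, ?_⟩
  · obtain ⟨φ, hφ⟩ := h𝓕ne
    obtain ⟨i, _⟩ := hk φ hφ
    exact ⟨_, i, rfl⟩
  · rintro _ ⟨i, rfl⟩
    exact ⟨(T i).measurable, fun x _ => hTY i x⟩
  intro φ hφ
  obtain ⟨i, hi⟩ := hk φ hφ
  have key : ∀ x ∈ X, sSup ((fun y => ⟪x, y⟫ - φ y) '' Y) ≤ (⟪x, T i x⟫ - φ (T i x)) + ε := by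
    intro x hx
    apply csSup_le (hYne.image _)
    rintro _ ⟨y, hy, rfl⟩
    have hty := hTY i x
    have h1 : ⟪P x, y⟫ - φs i y ≤ ⟪P x, T i x⟫ - φs i (T i x) := hgm i (P x) y hy
    have hd : ‖T i x - y‖ ≤ 2 * R := by
      have := norm_sub_le (T i x) y
      linarith [hR _ hty, hR _ hy]
    have h2 := (abs_le.1 (hi _ hty _ hy)).2
    have h3 : δ * ‖T i x - y‖ ≤ δ * (2 * R) := mul_le_mul_of_nonneg_left hd hδ.le
    have h4 : ⟪P x - x, T i x - y⟫ ≤ η * (2 * R) :=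
      (real_inner_le_norm _ _).trans
        (mul_le_mul (hP x hx) hd (norm_nonneg _) hη.le)
    rw [inner_sub_left, inner_sub_right, inner_sub_right] at h4
    show ⟪x, y⟫ - φ y ≤ _
    linarith
  have hφc := hcont φ hφ
  have hI1 : Integrable (fun x => sSup ((fun y => ⟪x, y⟫ - φ y) '' Y)) p := by
    have hc : Continuous (fun x : EuclideanSpace ℝ (Fin D) =>
        sSup ((fun y => ⟪x, y⟫ - φ y) '' Y)) := by
      refine hYc.continuous_sSup (f := fun x y => ⟪x, y⟫ - φ y) ?_
      exact (continuous_fst.inner continuous_snd).sub (hφc.comp continuous_snd)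
    have := hc.continuousOn.integrableOn_compact (μ := p) hXc
    rwa [IntegrableOn, hres] at this
  have hI2 : Integrable (fun x => ⟪x, T i x⟫ - φ (T i x)) p := by
    refine Integrable.sub ?_ ?_
    · refine Integrable.of_bound (C := C * R)
        (measurable_id.inner (T i).measurable).aestronglyMeasurable ?_
      filter_upwards [hae] with x hx
      exact (norm_inner_le_norm _ _).trans
        (mul_le_mul (hC x hx) (hR _ (hTY i x)) (norm_nonneg _) hCpos.le)
    · exact SimpleFunc.integrable_of_isFiniteMeasure ((T i).map φ)
  have h5 : ∫ x, sSup ((fun y => ⟪x, y⟫ - φ y) '' Y) ∂p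
      ≤ ∫ x, (⟪x, T i x⟫ - φ (T i x)) + ε ∂p := by
    refine integral_mono_ae hI1 (hI2.add (integrable_const ε)) ?_
    filter_upwards [hae] with x hx using key x hx
  rw [integral_add hI2 (integrable_const ε)] at h5
  have h6 : ∫ x, (⟪x, T i x⟫ - φ (T i x)) ∂p ≤
      sSup ((fun T : EuclideanSpace ℝ (Fin D) → EuclideanSpace ℝ (Fin D) =>
        ∫ x, (⟪x, T x⟫ - φ (T x)) ∂p) '' Set.range (fun i => (T i : _ → _))) :=
    le_csSup ((Set.finite_range _).image _).bddAbove ⟨_, ⟨i, rfl⟩, rfl⟩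
  simp only [integral_const, probReal_univ, one_smul] at h5
  linarith
end
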